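/- arXiv:2405.07068 — 4 statements merged into one kernel-verified Lean document; each statement's English description precedes it below -/
import Mathlib

section
/- For every premium vector p : {1,…,k} → ℝ and every δ ∈ ℝ, the robust coverage constraint '∑_{t=1}^k p_t − ∑_{t=1}^k l_t ≥ δ for all (l, z) ∈ U^ML' holds if and only if ∑_{t=1}^k p_t ≥ δ + L^ML. -/
/-- The relaxed ML uncertainty set: `(l, z)` with `l t ≥ 0`, `0 ≤ z t ≤ 1`,
`∑ l ≤ Θ·∑ z`, `|∑ z − q| ≤ ε`, and `∑ z ≤ 1` (sums over `t ∈ {1,…,k}`). -/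
def UML (k : ℕ) (Θ q ε : ℝ) (l z : ℕ → ℝ) : Prop :=
  (∀ t ∈ Finset.Icc 1 k, 0 ≤ l t) ∧
  (∀ t ∈ Finset.Icc 1 k, 0 ≤ z t ∧ z t ≤ 1) ∧
  (∑ t ∈ Finset.Icc 1 k, l t) ≤ Θ * (∑ t ∈ Finset.Icc 1 k, z t) ∧
  |(∑ t ∈ Finset.Icc 1 k, z t) - q| ≤ ε ∧
  (∑ t ∈ Finset.Icc 1 k, z t) ≤ 1

/-- `L^ML = Θ·min(1, q + ε)`. -/
def LML (Θ q ε : ℝ) : ℝ := Θ * min 1 (q + ε)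

/-- Concentrating everything at `t = 1` with the largest feasible total weight attains the
worst-case loss. -/
lemma UML_single {k : ℕ} (hk : 1 ≤ k) {Θ q ε : ℝ} (hΘ : 0 ≤ Θ) (hq0 : 0 ≤ q) (hq1 : q ≤ 1)
    (hε : 0 ≤ ε) :
    UML k Θ q ε (Pi.single 1 (LML Θ q ε)) (Pi.single 1 (min 1 (q + ε))) := by
  have hm0 : 0 ≤ min 1 (q + ε) := le_min zero_le_one (by linarith)
  have hm1 : min 1 (q + ε) ≤ 1 := min_le_left _ _
  have hsum (x : ℝ) : ∑ t ∈ Finset.Icc 1 k, (Pi.single 1 x : ℕ → ℝ) t = x := by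
    simp [Finset.sum_pi_single', hk]
  refine ⟨fun t _ => ?_, fun t _ => ?_, ?_, ?_, ?_⟩
  · exact (Pi.single_nonneg.2 (mul_nonneg hΘ hm0) : (0 : ℕ → ℝ) ≤ Pi.single 1 (LML Θ q ε)) t
  · by_cases ht : t = 1
    · subst ht
      simpa only [Pi.single_eq_same] using And.intro hm0 hm1
    · simp [Pi.single_eq_of_ne ht]
  · rw [hsum, hsum, LML]
  · rw [hsum, abs_sub_le_iff]
    have hqm : q ≤ min 1 (q + ε) := le_min hq1 (by linarith)
    have hmq : min 1 (q + ε) ≤ q + ε := min_le_right _ _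
    constructor <;> linarith
  · rwa [hsum]

lemma UML.sum_le_LML {k : ℕ} {Θ q ε : ℝ} {l z : ℕ → ℝ} (hΘ : 0 ≤ Θ) (h : UML k Θ q ε l z) :
    ∑ t ∈ Finset.Icc 1 k, l t ≤ LML Θ q ε := by
  obtain ⟨-, -, hl, hz, hz1⟩ := h
  refine hl.trans (mul_le_mul_of_nonneg_left (le_min hz1 ?_) hΘ)
  linarith [(abs_le.1 hz).2]

/-- The robust coverage constraint over `U^ML` holds iff
`∑_{t=1}^k p t ≥ δ + L^ML`. -/
theorem ml_robust_coverage_iff (k : ℕ) (hk : 1 ≤ k) (Θ q ε : ℝ)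
    (hΘ : 0 ≤ Θ) (hq0 : 0 ≤ q) (hq1 : q ≤ 1) (hε : 0 ≤ ε)
    (p : ℕ → ℝ) (δ : ℝ) :
    (∀ l z : ℕ → ℝ, UML k Θ q ε l z →
        (∑ t ∈ Finset.Icc 1 k, p t) - (∑ t ∈ Finset.Icc 1 k, l t) ≥ δ) ↔
      (∑ t ∈ Finset.Icc 1 k, p t) ≥ δ + LML Θ q ε := by
  constructor
  · intro h
    have hcov := h _ _ (UML_single hk hΘ hq0 hq1 hε)
    rw [Finset.sum_pi_single', if_pos (Finset.mem_Icc.2 ⟨le_rfl, hk⟩)] at hcov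
    linarith
  · intro h l z hU
    linarith [hU.sum_le_LML hΘ]
end

section
/- (Proposition, undamped form.) Let k ≤ T and δ ∈ ℝ. A premium vector p : {1,…,T} → ℝ satisfies both robust constraints — (i) ∑_{t=1}^T p_t − ∑_{t=1}^T l_t ≥ δ for every l ∈ U^CLT, and (ii) ∑_{t=1}^k p_t − ∑_{t=1}^k l_t ≥ δ for every (l, z) ∈ U^ML — if and only if ∑_{t=1}^T p_t ≥ δ + L^CLT and ∑_{t=1}^k p_t ≥ δ + L^ML. -/
/-- The CLT uncertainty set: losses `l : {1,…,T} → ℝ` with `l t ≥ 0` and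
`|∑_{t=1}^T l t − T·m̄| ≤ γ₂·σ·√T`. -/
def UCLT (T : ℕ) (m σ γ₂ : ℝ) (l : ℕ → ℝ) : Prop :=
  (∀ t ∈ Finset.Icc 1 T, 0 ≤ l t) ∧
    |(∑ t ∈ Finset.Icc 1 T, l t) - (T : ℝ) * m| ≤ γ₂ * σ * Real.sqrt T

/-- `L^CLT = T·m̄ + γ₂·σ·√T`. -/
noncomputable def LCLT (T : ℕ) (m σ γ₂ : ℝ) : ℝ :=
  (T : ℝ) * m + γ₂ * σ * Real.sqrt T

/-- Concentrating a mass `a` at the first index of `{1,…,n}` gives total mass `a`. -/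
lemma sum_Icc_one_single {n : ℕ} (hn : 1 ≤ n) (a : ℝ) :
    ∑ t ∈ Finset.Icc 1 n, (Pi.single 1 a : ℕ → ℝ) t = a := by
  rw [Finset.sum_pi_single', if_pos (Finset.mem_Icc.mpr ⟨le_rfl, hn⟩)]

lemma single_one_nonneg {a : ℝ} (ha : 0 ≤ a) (t : ℕ) : 0 ≤ (Pi.single 1 a : ℕ → ℝ) t := by
  rw [Pi.single_apply]
  split_ifs <;> linarith

lemma single_one_le_one {a : ℝ} (ha : a ≤ 1) (t : ℕ) : (Pi.single 1 a : ℕ → ℝ) t ≤ 1 := by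
  rw [Pi.single_apply]
  split_ifs <;> linarith

/-- The worst-case CLT loss `L^CLT` is attained. -/
lemma UCLT_single {T : ℕ} (hT : 1 ≤ T) {m σ γ₂ : ℝ} (hm : 0 ≤ m) (hσ : 0 ≤ σ) (hγ : 0 ≤ γ₂) :
    UCLT T m σ γ₂ (Pi.single 1 (LCLT T m σ γ₂)) := by
  have hL : 0 ≤ LCLT T m σ γ₂ := by unfold LCLT; positivity
  refine ⟨fun t _ => single_one_nonneg hL t, ?_⟩
  rw [sum_Icc_one_single hT, LCLT, add_sub_cancel_left, abs_of_nonneg (by positivity)]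

lemma UCLT.sum_le {T : ℕ} {m σ γ₂ : ℝ} {l : ℕ → ℝ} (h : UCLT T m σ γ₂ l) :
    ∑ t ∈ Finset.Icc 1 T, l t ≤ LCLT T m σ γ₂ := by
  have := (abs_le.mp h.2).2
  unfold LCLT
  linarith

lemma UML.sum_le {k : ℕ} {Θ q ε : ℝ} (hΘ : 0 ≤ Θ) {l z : ℕ → ℝ} (h : UML k Θ q ε l z) :
    ∑ t ∈ Finset.Icc 1 k, l t ≤ LML Θ q ε := by
  obtain ⟨-, -, hl, hz, hz1⟩ := h
  have := (abs_le.mp hz).2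
  exact hl.trans (mul_le_mul_of_nonneg_left (le_min hz1 (by linarith)) hΘ)

/-- (Proposition, undamped form.) A premium vector satisfies both robust constraints
iff `∑_{t=1}^T p t ≥ δ + L^CLT` and `∑_{t=1}^k p t ≥ δ + L^ML`. -/
theorem robust_both_iff (T : ℕ) (hT : 1 ≤ T) (m σ γ₂ : ℝ)
    (hm : 0 ≤ m) (hσ : 0 ≤ σ) (hγ : 0 ≤ γ₂)
    (k : ℕ) (hk : 1 ≤ k) (hkT : k ≤ T) (Θ q ε : ℝ)
    (hΘ : 0 ≤ Θ) (hq0 : 0 ≤ q) (hq1 : q ≤ 1) (hε : 0 ≤ ε)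
    (p : ℕ → ℝ) (δ : ℝ) :
    ((∀ l : ℕ → ℝ, UCLT T m σ γ₂ l →
        (∑ t ∈ Finset.Icc 1 T, p t) - (∑ t ∈ Finset.Icc 1 T, l t) ≥ δ) ∧
      (∀ l z : ℕ → ℝ, UML k Θ q ε l z →
        (∑ t ∈ Finset.Icc 1 k, p t) - (∑ t ∈ Finset.Icc 1 k, l t) ≥ δ)) ↔
      ((∑ t ∈ Finset.Icc 1 T, p t) ≥ δ + LCLT T m σ γ₂ ∧
        (∑ t ∈ Finset.Icc 1 k, p t) ≥ δ + LML Θ q ε) := by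
  constructor
  · rintro ⟨hC, hM⟩
    have h₁ := hC _ (UCLT_single hT hm hσ hγ)
    have h₂ := hM _ _ (UML_single hk hΘ hq0 hq1 hε)
    rw [sum_Icc_one_single hT] at h₁
    rw [sum_Icc_one_single hk] at h₂
    constructor <;> linarith
  · rintro ⟨hC, hM⟩
    refine ⟨fun l hl => ?_, fun l z hlz => ?_⟩
    · linarith [hl.sum_le]
    · linarith [hlz.sum_le hΘ]
end

section
/- (Dual certificate implies robust coverage under the affine decision rule.) Let T ≥ 2, α_1, …, α_T ∈ ℝ, β_2, …, β_T ∈ ℝ, and δ ∈ ℝ. Suppose there exist s₁, s₂ ≥ 0 with s₁ − s₂ ≥ 1 − β_t for all 2 ≤ t ≤ T, s₁ − s₂ ≥ 1, and −∑_{t=1}^T α_t + (T·m̄ + γ₂·σ·√T)·s₁ + (γ₂·σ·√T − T·m̄)·s₂ ≤ −δ. Then for every l ∈ U^CLT, the premiums p_1 = α_1 and p_t = α_t + β_t·l_{t−1} for 2 ≤ t ≤ T satisfy ∑_{t=1}^T p_t − ∑_{t=1}^T l_t ≥ δ. -/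
theorem sum_Icc_one_eq_sum_pred_add_last (l : ℕ → ℝ) {T : ℕ} (hT : 1 ≤ T) :
    ∑ t ∈ Finset.Icc 1 T, l t = (∑ t ∈ Finset.Icc 2 T, l (t - 1)) + l T := by
  induction T, hT using Nat.le_induction with
  | base => simp
  | succ n hn ih =>
    rw [Finset.sum_Icc_succ_top (by omega), Finset.sum_Icc_succ_top (by omega), ih,
      Nat.add_sub_cancel]

/-- (Dual certificate implies robust coverage under the affine decision rule
`p 1 = α 1`, `p t = α t + β t · l (t−1)` for `2 ≤ t ≤ T`.) -/
theorem aro_dual_certificate_implies_coverage (T : ℕ) (hT2 : 2 ≤ T) (m σ γ₂ : ℝ)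
    (hm : 0 ≤ m) (hσ : 0 ≤ σ) (hγ : 0 ≤ γ₂) (α β : ℕ → ℝ) (δ : ℝ)
    (s₁ s₂ : ℝ) (hs₁ : 0 ≤ s₁) (hs₂ : 0 ≤ s₂)
    (hfeas : ∀ t ∈ Finset.Icc 2 T, s₁ - s₂ ≥ 1 - β t) (hone : s₁ - s₂ ≥ 1)
    (hcert : -(∑ t ∈ Finset.Icc 1 T, α t) +
        ((T : ℝ) * m + γ₂ * σ * Real.sqrt T) * s₁ +
        (γ₂ * σ * Real.sqrt T - (T : ℝ) * m) * s₂ ≤ -δ) :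
    ∀ l : ℕ → ℝ, UCLT T m σ γ₂ l →
      (α 1 + ∑ t ∈ Finset.Icc 2 T, (α t + β t * l (t - 1))) -
        (∑ t ∈ Finset.Icc 1 T, l t) ≥ δ := by
  rintro l ⟨hl, habs⟩
  obtain ⟨hlower, hupper⟩ := abs_le.mp habs
  have hshift := sum_Icc_one_eq_sum_pred_add_last l (by omega : 1 ≤ T)
  have hα : ∑ t ∈ Finset.Icc 1 T, α t = α 1 + ∑ t ∈ Finset.Icc 2 T, α t :=
    (Finset.add_sum_Ioc_eq_sum_Icc (f := α) (by omega : 1 ≤ T)).symm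
  have hterms : ∑ t ∈ Finset.Icc 2 T, (1 - β t) * l (t - 1) ≤
      (s₁ - s₂) * ∑ t ∈ Finset.Icc 2 T, l (t - 1) := by
    rw [Finset.mul_sum]
    refine Finset.sum_le_sum fun t ht => mul_le_mul_of_nonneg_right (hfeas t ht) (hl _ ?_)
    rw [Finset.mem_Icc] at ht ⊢
    omega
  have hlast : 1 * l T ≤ (s₁ - s₂) * l T :=
    mul_le_mul_of_nonneg_right hone (hl T (Finset.mem_Icc.mpr ⟨by omega, le_rfl⟩))
  simp only [sub_mul, one_mul, Finset.sum_sub_distrib] at hterms hlast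
  rw [Finset.sum_add_distrib]
  have hs₁upper := mul_le_mul_of_nonneg_left hupper hs₁
  have hs₂lower := mul_le_mul_of_nonneg_left hlower hs₂
  rw [hα] at hcert
  rw [hshift] at hs₁upper hs₂lower ⊢
  linarith
end

section
/- (Robust counterpart of the positivity constraint under the affine decision rule.) Let T ≥ 2, fix t with 2 ≤ t ≤ T, and let α_t, β_t ∈ ℝ. Then 'α_t + β_t·l_{t−1} ≥ 0 for all l ∈ U^CLT' holds if and only if there exist s₁, s₂ ≥ 0 with s₁ − s₂ ≥ −β_t, s₁ − s₂ ≥ 0, and −α_t + (T·m̄ + γ₂·σ·√T)·s₁ + (γ₂·σ·√T − T·m̄)·s₂ ≤ 0; equivalently, if and only if α_t ≥ L^CLT · max(0, −β_t). -/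
/-- The point mass `c` at `k` belongs to the uncertainty set when the total loss `c` does. -/
theorem UCLT_single_s13 {T k : ℕ} {m σ γ₂ c : ℝ} (hk : k ∈ Finset.Icc 1 T) (hc : 0 ≤ c)
    (hsum : |c - (T : ℝ) * m| ≤ γ₂ * σ * Real.sqrt T) :
    UCLT T m σ γ₂ (Pi.single k c) := by
  refine ⟨fun i _ => (Pi.single_nonneg.mpr hc : (0 : ℕ → ℝ) ≤ Pi.single k c) i, ?_⟩
  rwa [Finset.sum_pi_single', if_pos hk]

/-- No single loss in the uncertainty set exceeds `L^CLT`. -/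
theorem UCLT.le_LCLT {T k : ℕ} {m σ γ₂ : ℝ} {l : ℕ → ℝ} (hl : UCLT T m σ γ₂ l)
    (hk : k ∈ Finset.Icc 1 T) : l k ≤ LCLT T m σ γ₂ := by
  have hle := Finset.single_le_sum hl.1 hk
  have hsum := (abs_le.mp hl.2).2
  unfold LCLT
  linarith

/-- Over the uncertainty set, the worst case of `a + b * l k` is `a - L^CLT * max 0 (-b)`. -/
theorem forall_UCLT_affine_nonneg_iff {T k : ℕ} (hT : 2 ≤ T) (hk : k ∈ Finset.Icc 1 T)
    {m σ γ₂ : ℝ} (hm : 0 ≤ m) (hσ : 0 ≤ σ) (hγ : 0 ≤ γ₂) (a b : ℝ) :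
    (∀ l : ℕ → ℝ, UCLT T m σ γ₂ l → a + b * l k ≥ 0) ↔ a ≥ LCLT T m σ γ₂ * max 0 (-b) := by
  have hr : 0 ≤ γ₂ * σ * Real.sqrt T := by positivity
  have hTm : 0 ≤ (T : ℝ) * m := by positivity
  constructor
  · intro h
    rcases le_total 0 (-b) with hb | hb
    · have hL := h _ (UCLT_single_s13 (c := LCLT T m σ γ₂) hk (add_nonneg hTm hr)
        (by simp only [LCLT, add_sub_cancel_left, abs_of_nonneg hr, le_refl]))
      rw [Pi.single_eq_same] at hL
      rw [max_eq_right hb]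
      linarith
    · obtain ⟨j, hj, hjk⟩ : ∃ j ∈ Finset.Icc 1 T, k ≠ j := by
        by_cases h1 : k = 1
        · exact ⟨2, Finset.mem_Icc.mpr ⟨by lia, hT⟩, by lia⟩
        · exact ⟨1, Finset.mem_Icc.mpr ⟨le_rfl, by lia⟩, h1⟩
      have h0 := h _ (UCLT_single_s13 (c := (T : ℝ) * m) hj hTm (by simpa using hr))
      rw [Pi.single_eq_of_ne hjk] at h0
      rw [max_eq_left hb]
      linarith
  · intro h l hl
    have h1 : l k * -b ≤ l k * max 0 (-b) :=
      mul_le_mul_of_nonneg_left (le_max_right _ _) (hl.1 k hk)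
    have h2 : l k * max 0 (-b) ≤ LCLT T m σ γ₂ * max 0 (-b) :=
      mul_le_mul_of_nonneg_right (hl.le_LCLT hk) (le_max_left _ _)
    linarith

/-- Dual certificates exist exactly when `a` dominates `(A + r) * max 0 (-b)`. -/
theorem exists_dual_certificate_iff {A r : ℝ} (hA : 0 ≤ A) (hr : 0 ≤ r) (a b : ℝ) :
    (∃ s₁ s₂ : ℝ, 0 ≤ s₁ ∧ 0 ≤ s₂ ∧ s₁ - s₂ ≥ -b ∧ s₁ - s₂ ≥ 0 ∧
      -a + (A + r) * s₁ + (r - A) * s₂ ≤ 0) ↔ a ≥ (A + r) * max 0 (-b) := by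
  constructor
  · rintro ⟨s₁, s₂, -, hs₂, hb, h0, h⟩
    have h1 : (A + r) * max 0 (-b) ≤ (A + r) * (s₁ - s₂) :=
      mul_le_mul_of_nonneg_left (max_le h0 hb) (add_nonneg hA hr)
    linarith [mul_nonneg hr hs₂]
  · intro h
    refine ⟨max 0 (-b), 0, le_max_left _ _, le_rfl, ?_, ?_, ?_⟩
    · simp
    · simp
    · linarith

/-- (Robust counterpart of the positivity constraint under the affine decision rule.)
For fixed `t` with `2 ≤ t ≤ T`, `α t + β t · l (t−1) ≥ 0` for all `l ∈ U^CLT` iff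
a dual certificate exists, equivalently iff `α t ≥ L^CLT · max(0, −β t)`. -/
theorem aro_positivity_robust_counterpart (T : ℕ) (hT2 : 2 ≤ T) (m σ γ₂ : ℝ)
    (hm : 0 ≤ m) (hσ : 0 ≤ σ) (hγ : 0 ≤ γ₂)
    (t : ℕ) (ht1 : 2 ≤ t) (ht2 : t ≤ T) (αt βt : ℝ) :
    ((∀ l : ℕ → ℝ, UCLT T m σ γ₂ l → αt + βt * l (t - 1) ≥ 0) ↔
      (∃ s₁ s₂ : ℝ, 0 ≤ s₁ ∧ 0 ≤ s₂ ∧ s₁ - s₂ ≥ -βt ∧ s₁ - s₂ ≥ 0 ∧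
        -αt + ((T : ℝ) * m + γ₂ * σ * Real.sqrt T) * s₁ +
          (γ₂ * σ * Real.sqrt T - (T : ℝ) * m) * s₂ ≤ 0)) ∧
    ((∀ l : ℕ → ℝ, UCLT T m σ γ₂ l → αt + βt * l (t - 1) ≥ 0) ↔
      αt ≥ LCLT T m σ γ₂ * max 0 (-βt)) := by
  have hk : t - 1 ∈ Finset.Icc 1 T := Finset.mem_Icc.mpr (by lia)
  have h := forall_UCLT_affine_nonneg_iff hT2 hk hm hσ hγ αt βt
  exact ⟨h.trans (exists_dual_certificate_iff (by positivity) (by positivity) αt βt).symm, h⟩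
end
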